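/- For each υ ∈ {0,1}, the canonical maps 𝒪_q(Mat_N) → 𝒲_{υυ} and 𝒪_q(Mat_N)^op → 𝒲_{υυ} are well-defined k-algebra homomorphisms, and the k-linear map 𝒪_q(Mat_N) ⊗_k 𝒪_q(Mat_N)^op → 𝒲_{υυ} sending f ⊗ g to the product of the canonical images of f and g is a bijection; i.e., the quantum Weyl algebra 𝒲_{υυ} is a PBW deformation of the graded twisted tensor product 𝒜_{υυ} in which the deformed cross relations carry the constant term δ_{ef} δ_{ab}. -/

import Mathlib

open scoped BigOperators TensorProduct

noncomputable section

abbrev K : Type := RatFunc ℂ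

def q : K := RatFunc.X

/-- The standard R-matrix of `U_q(gl_N)`: the coefficient of `e_{ik} ⊗ e_{jl}` is the
entry at row `(i,j)`, column `(k,l)`. -/
def Rmat (N : ℕ) : Matrix (Fin N × Fin N) (Fin N × Fin N) K :=
  Matrix.of fun p c =>
    if p.1 = c.1 ∧ p.2 = c.2 then (if p.1 = p.2 then q else 1)
    else if p.1 = c.2 ∧ p.2 = c.1 ∧ c.1 < p.1 then q - q⁻¹
    else 0

/-- partial transpose in the first tensor factor -/
def pt1 {N : ℕ} {α : Type} (C : Matrix (Fin N × Fin N) (Fin N × Fin N) α) :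
    Matrix (Fin N × Fin N) (Fin N × Fin N) α :=
  Matrix.of fun p c => C (c.1, p.2) (p.1, c.2)

/-- partial transpose in the second tensor factor -/
def pt2 {N : ℕ} {α : Type} (C : Matrix (Fin N × Fin N) (Fin N × Fin N) α) :
    Matrix (Fin N × Fin N) (Fin N × Fin N) α :=
  Matrix.of fun p c => C (p.1, c.2) (c.1, p.2)

/-- flip of the two tensor factors -/
def flip21 {N : ℕ} {α : Type} (C : Matrix (Fin N × Fin N) (Fin N × Fin N) α) :
    Matrix (Fin N × Fin N) (Fin N × Fin N) α :=
  Matrix.of fun p c => C (p.2, p.1) (c.2, c.1)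

/-- `R₀ = R` and `R₁ = R₂₁⁻¹`. -/
def Rv (N : ℕ) (i : Fin 2) : Matrix (Fin N × Fin N) (Fin N × Fin N) K :=
  if i = 0 then Rmat N else (flip21 (Rmat N))⁻¹

/-- the generator `t_{ij}` of the free algebra -/
def Tg {n : ℕ} (i j : Fin n) : FreeAlgebra K (Fin n × Fin n) := FreeAlgebra.ι K (i, j)

/-- defining relations of `𝒪_q(Mat_n)` -/
inductive matRel (n : ℕ) :
    FreeAlgebra K (Fin n × Fin n) → FreeAlgebra K (Fin n × Fin n) → Prop
  | rowq (l i j : Fin n) (h : i < j) :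
      matRel n (Tg l i * Tg l j) (q • (Tg l j * Tg l i))
  | colq (l i j : Fin n) (h : i < j) :
      matRel n (Tg i l * Tg j l) (q • (Tg j l * Tg i l))
  | anti (i k j l : Fin n) (h1 : i < k) (h2 : j < l) :
      matRel n (Tg i l * Tg k j) (Tg k j * Tg i l)
  | main (i k j l : Fin n) (h1 : i < k) (h2 : j < l) :
      matRel n (Tg i j * Tg k l) (Tg k l * Tg i j + (q - q⁻¹) • (Tg k j * Tg i l))

/-- the quantized function algebra `𝒪_q(Mat_n)` -/
abbrev OqMat (n : ℕ) := RingQuot (matRel n)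

/-- the generator `t_{ij}` of `𝒪_q(Mat_n)` -/
def tGen {n : ℕ} (i j : Fin n) : OqMat n :=
  RingQuot.mkAlgHom K (matRel n) (Tg i j)

/-- defining relations of `𝒪_q(Mat_n)^{op}` (generators `∂_{ij}`) -/
inductive matRelOp (n : ℕ) :
    FreeAlgebra K (Fin n × Fin n) → FreeAlgebra K (Fin n × Fin n) → Prop
  | rowq (l i j : Fin n) (h : i < j) :
      matRelOp n (Tg l j * Tg l i) (q • (Tg l i * Tg l j))
  | colq (l i j : Fin n) (h : i < j) :
      matRelOp n (Tg j l * Tg i l) (q • (Tg i l * Tg j l))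
  | anti (i k j l : Fin n) (h1 : i < k) (h2 : j < l) :
      matRelOp n (Tg k j * Tg i l) (Tg i l * Tg k j)
  | main (i k j l : Fin n) (h1 : i < k) (h2 : j < l) :
      matRelOp n (Tg k l * Tg i j) (Tg i j * Tg k l + (q - q⁻¹) • (Tg i l * Tg k j))

/-- the opposite quantized function algebra -/
abbrev OqMatOp (n : ℕ) := RingQuot (matRelOp n)

/-- the generator `∂_{ij}` of `𝒪_q(Mat_n)^{op}` -/
def pGen {n : ℕ} (i j : Fin n) : OqMatOp n :=
  RingQuot.mkAlgHom K (matRelOp n) (Tg i j)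

/-- the generator `t_{ij}` inside the big free algebra -/
def tF {N : ℕ} (i j : Fin N) : FreeAlgebra K ((Fin N × Fin N) ⊕ (Fin N × Fin N)) :=
  FreeAlgebra.ι K (Sum.inl (i, j))

/-- the generator `∂_{ij}` inside the big free algebra -/
def dF {N : ℕ} (i j : Fin N) : FreeAlgebra K ((Fin N × Fin N) ⊕ (Fin N × Fin N)) :=
  FreeAlgebra.ι K (Sum.inr (i, j))

/-- the defining relations of the quantum Weyl algebra `𝒲_{υυ}` -/
inductive wRel (N : ℕ) (υ : Fin 2) :
    FreeAlgebra K ((Fin N × Fin N) ⊕ (Fin N × Fin N)) →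
      FreeAlgebra K ((Fin N × Fin N) ⊕ (Fin N × Fin N)) → Prop
  | trowq (l i j : Fin N) (h : i < j) :
      wRel N υ (tF l i * tF l j) (q • (tF l j * tF l i))
  | tcolq (l i j : Fin N) (h : i < j) :
      wRel N υ (tF i l * tF j l) (q • (tF j l * tF i l))
  | tanti (i k j l : Fin N) (h1 : i < k) (h2 : j < l) :
      wRel N υ (tF i l * tF k j) (tF k j * tF i l)
  | tmain (i k j l : Fin N) (h1 : i < k) (h2 : j < l) :
      wRel N υ (tF i j * tF k l) (tF k l * tF i j + (q - q⁻¹) • (tF k j * tF i l))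
  | drowq (l i j : Fin N) (h : i < j) :
      wRel N υ (dF l j * dF l i) (q • (dF l i * dF l j))
  | dcolq (l i j : Fin N) (h : i < j) :
      wRel N υ (dF j l * dF i l) (q • (dF i l * dF j l))
  | danti (i k j l : Fin N) (h1 : i < k) (h2 : j < l) :
      wRel N υ (dF k j * dF i l) (dF i l * dF k j)
  | dmain (i k j l : Fin N) (h1 : i < k) (h2 : j < l) :
      wRel N υ (dF k l * dF i j) (dF i j * dF k l + (q - q⁻¹) • (dF i l * dF k j))
  | cross (e a f b : Fin N) :
      wRel N υ (dF e a * tF f b)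
        ((∑ d : Fin N, ∑ l : Fin N, ∑ j : Fin N, ∑ m : Fin N,
          (pt2 (Rv N υ) (d, l) (f, e) * pt2 (Rv N υ) (j, m) (b, a)) • (tF d j * dF l m)) +
         algebraMap K (FreeAlgebra K ((Fin N × Fin N) ⊕ (Fin N × Fin N)))
           ((if e = f then (1 : K) else 0) * (if a = b then (1 : K) else 0)))

/-- the quantum Weyl algebra `𝒲_{υυ}` -/
abbrev Wtt (N : ℕ) (υ : Fin 2) := RingQuot (wRel N υ)

/-- the class of `t_{ij}` in `𝒲_{υυ}` -/
def tWtt (N : ℕ) (υ : Fin 2) (i j : Fin N) : Wtt N υ :=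
  RingQuot.mkAlgHom K (wRel N υ) (tF i j)

/-- the class of `∂_{ij}` in `𝒲_{υυ}` -/
def dWtt (N : ℕ) (υ : Fin 2) (i j : Fin N) : Wtt N υ :=
  RingQuot.mkAlgHom K (wRel N υ) (dF i j)

section Sandwich

variable {k : Type*} [CommRing k] {ι : Type*} [Fintype ι] {M M' : Type*}
  [AddCommGroup M] [Module k M] [AddCommGroup M'] [Module k M']

/-- The two-sided product `A Z B` of a module-valued matrix `Z` with scalar matrices. -/
def sandwich (A : Matrix ι ι k) (Z : ι → ι → M) (B : Matrix ι ι k) : ι → ι → M :=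
  fun p c => ∑ r, ∑ s, (A p r * B s c) • Z r s

theorem sandwich_sandwich (A A' B B' : Matrix ι ι k) (Z : ι → ι → M) :
    sandwich A (sandwich A' Z B') B = sandwich (A * A') Z (B' * B) := by
  funext p c
  simp only [sandwich, Matrix.mul_apply, Finset.smul_sum, Finset.sum_mul, Finset.mul_sum,
    Finset.sum_smul, smul_smul]
  rw [Finset.sum_congr rfl fun r _ => Finset.sum_comm, Finset.sum_comm]
  refine Finset.sum_congr rfl fun x _ => ?_
  rw [Finset.sum_congr rfl fun r _ => Finset.sum_comm, Finset.sum_comm]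
  refine Finset.sum_congr rfl fun y _ => ?_
  rw [Finset.sum_comm]
  refine Finset.sum_congr rfl fun a _ => Finset.sum_congr rfl fun b _ => ?_
  congr 1
  ring

theorem sandwich_add (A B : Matrix ι ι k) (Z Z' : ι → ι → M) :
    sandwich A (Z + Z') B = sandwich A Z B + sandwich A Z' B := by
  funext p c
  simp [sandwich, Finset.sum_add_distrib]

theorem add_sandwich (A A' B : Matrix ι ι k) (Z : ι → ι → M) :
    sandwich (A + A') Z B = sandwich A Z B + sandwich A' Z B := by
  funext p c
  simp [sandwich, Finset.sum_add_distrib, add_mul, add_smul]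

theorem sandwich_add_right (A B B' : Matrix ι ι k) (Z : ι → ι → M) :
    sandwich A Z (B + B') = sandwich A Z B + sandwich A Z B' := by
  funext p c
  simp [sandwich, Finset.sum_add_distrib, mul_add, add_smul]

theorem smul_sandwich (a : k) (A B : Matrix ι ι k) (Z : ι → ι → M) :
    sandwich (a • A) Z B = a • sandwich A Z B := by
  funext p c
  simp [sandwich, Finset.smul_sum, smul_smul, mul_assoc]

theorem sandwich_smul_right (a : k) (A B : Matrix ι ι k) (Z : ι → ι → M) :
    sandwich A Z (a • B) = a • sandwich A Z B := by
  funext p c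
  simp [sandwich, Finset.smul_sum, smul_smul, mul_left_comm]

theorem sandwich_sum {κ : Type*} (s : Finset κ) (A B : Matrix ι ι k) (Z : κ → ι → ι → M) :
    sandwich A (∑ x ∈ s, Z x) B = ∑ x ∈ s, sandwich A (Z x) B := by
  classical
  induction s using Finset.induction_on with
  | empty => funext p c; simp [sandwich]
  | insert x s hx ih => simp [Finset.sum_insert hx, sandwich_add, ih]

theorem sandwich_map (f : M →ₗ[k] M') (A B : Matrix ι ι k) (Z : ι → ι → M) :
    sandwich A (fun r s => f (Z r s)) B = fun r s => f (sandwich A Z B r s) := by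
  funext p c
  simp [sandwich]

variable [DecidableEq ι]

theorem sandwich_one_apply (A : Matrix ι ι k) (Z : ι → ι → M) (p c : ι) :
    sandwich A Z 1 p c = ∑ r, A p r • Z r c := by
  simp [sandwich, Matrix.one_apply]

theorem one_sandwich_apply (B : Matrix ι ι k) (Z : ι → ι → M) (p c : ι) :
    sandwich 1 Z B p c = ∑ s, B s c • Z p s := by
  simp [sandwich, Matrix.one_apply]

/-- The module-valued matrix `Z` satisfies `G Z = Z G`. -/
def Intertwines (G : Matrix ι ι k) (Z : ι → ι → M) : Prop :=
  sandwich G Z 1 = sandwich 1 Z G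

namespace Intertwines

variable {G : Matrix ι ι k} {Z Z' : ι → ι → M}

theorem zero : Intertwines G (0 : ι → ι → M) := by
  funext p c
  simp [sandwich]

theorem add (h : Intertwines G Z) (h' : Intertwines G Z') : Intertwines G (Z + Z') := by
  rw [Intertwines, sandwich_add, sandwich_add, h, h']

theorem sum {κ : Type*} {s : Finset κ} {Z : κ → ι → ι → M}
    (h : ∀ x ∈ s, Intertwines G (Z x)) : Intertwines G (∑ x ∈ s, Z x) := by
  rw [Intertwines, sandwich_sum, sandwich_sum]
  exact Finset.sum_congr rfl h

theorem map (h : Intertwines G Z) (f : M →ₗ[k] M') :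
    Intertwines G (fun r s => f (Z r s)) := by
  rw [Intertwines, sandwich_map, sandwich_map, h]

theorem conj (h : Intertwines G Z) {A B : Matrix ι ι k} (hA : Commute G A) (hB : Commute G B) :
    Intertwines G (sandwich A Z B) := by
  have h1 := congrArg (fun Z => sandwich A Z B) h
  simp only [sandwich_sandwich, one_mul, mul_one] at h1
  rw [Intertwines, sandwich_sandwich, sandwich_sandwich, one_mul, mul_one, hA.eq, h1, hB.eq]

/-- For a Hecke-type matrix `G`, anticommutators of the form `G Z G + Z` intertwine. -/
theorem of_hecke {μ : k} (hG : G * G = μ • G + 1) (Z : ι → ι → M) :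
    Intertwines G (sandwich G Z G + Z) := by
  simp only [Intertwines, sandwich_add, sandwich_sandwich, hG, one_mul, mul_one, add_sandwich,
    sandwich_add_right, smul_sandwich, sandwich_smul_right]
  abel

theorem sub_smul_one_iff (μ : k) : Intertwines (G + μ • 1) Z ↔ Intertwines G Z := by
  simp [Intertwines, add_sandwich, sandwich_add_right, smul_sandwich, sandwich_smul_right]

end Intertwines
end Sandwich

section Hecke

variable {k : Type*} [CommRing k] {I : Type*} [Fintype I] [DecidableEq I]

/-- The transfer matrix obtained by moving one strand, entering as `e` and leaving as `l`, past
two others. -/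
def transfer (G : Matrix (I × I) (I × I) k) (e l : I) : Matrix (I × I) (I × I) k :=
  Matrix.of fun p c => ∑ m, G (e, p.1) (c.1, m) * G (m, p.2) (c.2, l)

/-- `G` acting on the first two of three tensor factors -/
def leftLeg (G : Matrix (I × I) (I × I) k) : Matrix (I × I × I) (I × I × I) k :=
  Matrix.of fun p c => G (p.1, p.2.1) (c.1, c.2.1) * (if p.2.2 = c.2.2 then 1 else 0)

/-- `G` acting on the last two of three tensor factors -/
def rightLeg (G : Matrix (I × I) (I × I) k) : Matrix (I × I × I) (I × I × I) k :=
  Matrix.of fun p c => (if p.1 = c.1 then 1 else 0) * G p.2 c.2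

theorem transfer_apply (G : Matrix (I × I) (I × I) k) (e l : I) (p c : I × I) :
    transfer G e l p c = (leftLeg G * rightLeg G) (e, p) (c.1, c.2, l) := by
  simp [transfer, leftLeg, rightLeg, Matrix.mul_apply, Fintype.sum_prod_type]

theorem commute_transfer {G : Matrix (I × I) (I × I) k}
    (h : leftLeg G * rightLeg G * leftLeg G = rightLeg G * leftLeg G * rightLeg G) (e l : I) :
    Commute G (transfer G e l) := by
  ext p c
  have h1 := congrFun (congrFun h (e, p)) (c.1, c.2, l)
  rw [mul_assoc (rightLeg G)] at h1
  rw [Matrix.mul_apply, Matrix.mul_apply] at h1 ⊢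
  simp only [transfer_apply]
  rw [Fintype.sum_prod_type, Fintype.sum_prod_type] at h1
  simp [Fintype.sum_prod_type] at h1 ⊢
  generalize leftLeg G * rightLeg G = Y at *
  simpa [leftLeg, rightLeg] using h1.symm

/-- The Hecke-type braiding attached to a strict total order `r`. -/
def hecke (a b : k) (r : I → I → Prop) [DecidableRel r] : Matrix (I × I) (I × I) k :=
  Matrix.of fun p c =>
    (if c = p.swap then (if p.1 = p.2 then a else 1) else 0) +
      (if c = p then (if r p.1 p.2 then a - b else 0) else 0)

variable (a b : k) (r : I → I → Prop) [DecidableRel r]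

theorem sum_hecke_smul {M : Type*} [AddCommGroup M] [Module k M] (f : I × I → M) (i j : I) :
    ∑ c, hecke a b r (i, j) c • f c =
      (if i = j then a else 1) • f (j, i) + (if r i j then a - b else 0) • f (i, j) := by
  simp [hecke, add_smul, Finset.sum_add_distrib, ite_smul]

omit [Fintype I] in
theorem hecke_symm (p c : I × I) : hecke a b r p c = hecke a b r c p := by
  obtain ⟨i, j⟩ := p
  obtain ⟨k, l⟩ := c
  simp only [hecke, Matrix.of_apply, Prod.swap, Prod.mk.injEq]
  grind

theorem hecke_mul_self [IsStrictTotalOrder I r] (hab : a * b = 1) :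
    hecke a b r * hecke a b r = (a - b) • hecke a b r + 1 := by
  ext ⟨i, j⟩ c
  have h := sum_hecke_smul a b r (fun x => hecke a b r x c) i j
  simp only [smul_eq_mul] at h
  rw [Matrix.mul_apply, h]
  obtain ⟨k, l⟩ := c
  have h1 : r i j → ¬ r j i := asymm_of r
  have h2 : ¬ r i i := irrefl_of r i
  have h3 := trichotomous_of r i j
  simp only [hecke, Matrix.of_apply, Matrix.add_apply, Matrix.smul_apply, Matrix.one_apply,
    Prod.swap, Prod.mk.injEq, smul_eq_mul]
  rcases h3 with h3 | h3 | h3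
  · have : i ≠ j := by rintro rfl; exact h2 h3
    have h4 := h1 h3
    simp only [this, this.symm, h3, h4, if_true, if_false]
    grind
  · subst h3
    grind
  · have : i ≠ j := by rintro rfl; exact h2 h3
    have h4 : ¬ r i j := asymm_of r h3
    simp only [this, this.symm, h3, h4, if_true, if_false]
    grind

theorem sum_hecke_smul_col {M : Type*} [AddCommGroup M] [Module k M] (f : I × I → M) (i j : I) :
    ∑ c, hecke a b r c (i, j) • f c =
      (if i = j then a else 1) • f (j, i) + (if r i j then a - b else 0) • f (i, j) := by
  simp only [fun c => hecke_symm a b r c (i, j), sum_hecke_smul]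

theorem leftLeg_hecke_mulVec (f : I × I × I → k) (i j l : I) :
    (leftLeg (hecke a b r)).mulVec f (i, j, l) =
      (if i = j then a else 1) * f (j, i, l) + (if r i j then a - b else 0) * f (i, j, l) := by
  have h := sum_hecke_smul a b r (fun x => f (x.1, x.2, l)) i j
  simpa [Fintype.sum_prod_type, leftLeg, Matrix.mulVec, dotProduct] using h

theorem rightLeg_hecke_mulVec (f : I × I × I → k) (i j l : I) :
    (rightLeg (hecke a b r)).mulVec f (i, j, l) =
      (if j = l then a else 1) * f (i, l, j) + (if r j l then a - b else 0) * f (i, j, l) := by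
  have h := sum_hecke_smul a b r (fun x => f (i, x)) j l
  simpa [Fintype.sum_prod_type, rightLeg, Matrix.mulVec, dotProduct] using h

theorem hecke_braid [IsStrictTotalOrder I r] (hab : a * b = 1) :
    leftLeg (hecke a b r) * rightLeg (hecke a b r) * leftLeg (hecke a b r) =
      rightLeg (hecke a b r) * leftLeg (hecke a b r) * rightLeg (hecke a b r) := by
  apply Matrix.mulVec_injective
  funext f ⟨i, j, l⟩
  simp only [← Matrix.mulVec_mulVec, leftLeg_hecke_mulVec, rightLeg_hecke_mulVec]
  have irr : ∀ x, ¬ r x x := irrefl_of r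
  have asy : ∀ x y, r x y → ¬ r y x := fun x y => asymm_of r
  have tr : ∀ x y z, r x y → r y z → r x z := fun x y z => trans_of r
  have ne : ∀ x y, r x y → x ≠ y := by
    rintro x _ h rfl
    exact irr x h
  rcases trichotomous_of r i j with h1 | h1 | h1 <;>
  rcases trichotomous_of r j l with h2 | h2 | h2 <;>
  rcases trichotomous_of r i l with h3 | h3 | h3 <;>
  grind

end Hecke

section QuantumMatrix

variable {k : Type*} [CommRing k] {C C' : Type*} [Ring C] [Algebra k C] [Ring C'] [Algebra k C']
  {N : ℕ}

/-- The defining relations of the quantized function algebra, with parameter `a = b⁻¹`. -/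
structure IsQuantumMatrix (a b : k) (t : Fin N → Fin N → C) : Prop where
  row : ∀ l i j, i < j → t l i * t l j = a • (t l j * t l i)
  col : ∀ l i j, i < j → t i l * t j l = a • (t j l * t i l)
  anti : ∀ i k j l, i < k → j < l → t i l * t k j = t k j * t i l
  main : ∀ i k j l, i < k → j < l →
    t i j * t k l = t k l * t i j + (a - b) • (t k j * t i l)

theorem IsQuantumMatrix.map {a b : k} {t : Fin N → Fin N → C} (h : IsQuantumMatrix a b t)
    (f : C →ₐ[k] C') : IsQuantumMatrix a b fun i j => f (t i j) where
  row l i j hij := by simpa using congrArg f (h.row l i j hij)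
  col l i j hij := by simpa using congrArg f (h.col l i j hij)
  anti i k j l h1 h2 := by simpa using congrArg f (h.anti i k j l h1 h2)
  main i k j l h1 h2 := by simpa using congrArg f (h.main i k j l h1 h2)

/-- The quantum matrix relations are equivalent to the `RTT` relation. -/
theorem isQuantumMatrix_iff {a b : k} (hab : a * b = 1) (t : Fin N → Fin N → C) :
    IsQuantumMatrix a b t ↔
      Intertwines (hecke a b (· < ·)) fun p c : Fin N × Fin N => t p.1 c.1 * t p.2 c.2 := by
  have key : (Intertwines (hecke a b (· < ·)) fun p c : Fin N × Fin N => t p.1 c.1 * t p.2 c.2) ↔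
      ∀ i j m l, (if i = j then a else 1) • (t j m * t i l) +
        (if i < j then a - b else 0) • (t i m * t j l) =
        (if m = l then a else 1) • (t i l * t j m) +
          (if m < l then a - b else 0) • (t i m * t j l) := by
    simp only [Intertwines, funext_iff, Prod.forall, sandwich_one_apply, one_sandwich_apply]
    refine forall_congr' fun i => forall_congr' fun j => forall_congr' fun m =>
      forall_congr' fun l => ?_
    rw [sum_hecke_smul, sum_hecke_smul_col]
  rw [key]
  have cancel : ∀ x y : C, a • x = a • y → x = y := fun x y h => by
    simpa [smul_smul, mul_comm b a, hab] using congrArg (b • ·) h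
  have swap : ∀ x y : C, x = a • y → b • x = y := by
    rintro x y rfl
    rw [smul_smul, mul_comm, hab, one_smul]
  constructor
  · intro h i j m l
    rcases lt_trichotomy i j with hij | rfl | hij <;> rcases lt_trichotomy m l with hml | rfl | hml
    · simp [hij, hml, hij.ne, hml.ne, h.anti i j m l hij hml]
    · simp only [hij, hij.ne, if_true, if_false, lt_irrefl, h.col m i j hij]
      linear_combination (norm := module) (-hab) • (t j m * t i m)
    · simp [hij, hml.not_gt, hij.ne, hml.ne', h.main i j l m hij hml,
        (h.anti i j l m hij hml)]
    · have := swap _ _ (h.row i m l hml)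
      simp [hml, hml.ne, ← this, sub_smul]
    · simp
    · simp [hml.not_gt, hml.ne', h.row i l m hml]
    · simp [hij.not_gt, hml, hij.ne', hml.ne, h.main j i m l hij hml]
    · simp [hij.not_gt, hij.ne', h.col m j i hij]
    · simp [hij.not_gt, hml.not_gt, hij.ne', hml.ne', h.anti j i l m hij hml]
  · intro h
    have anti : ∀ i k j l, i < k → j < l → t i l * t k j = t k j * t i l := by
      intro i k j l hik hjl
      simpa [hik, hjl, hik.ne, hjl.ne, eq_comm] using h i k j l
    refine ⟨fun l i j hij => ?_, fun l i j hij => ?_, anti, fun i k j l hik hjl => ?_⟩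
    · simpa [hij.not_gt, hij.ne', eq_comm] using h l l j i
    · simpa [hij.not_gt, hij.ne', eq_comm] using h j i l l
    · simpa [hik, hjl.not_gt, hik.ne, hjl.ne', anti i k j l hik hjl, eq_comm] using h i k l j

theorem isQuantumMatrix_op_iff {a b : k} (hab : a * b = 1) (d : Fin N → Fin N → C) :
    IsQuantumMatrix a b (fun i j => MulOpposite.op (d i j)) ↔
      Intertwines (hecke a b (· < ·)) fun p c : Fin N × Fin N => d p.2 c.2 * d p.1 c.1 := by
  rw [isQuantumMatrix_iff hab]
  constructor
  · exact fun h => h.map (MulOpposite.opLinearEquiv k).symm.toLinearMap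
  · exact fun h => h.map (MulOpposite.opLinearEquiv k).toLinearMap

end QuantumMatrix

section Crossing

variable {k : Type*} [CommRing k] {I : Type*} [Fintype I] [DecidableEq I]
  {A : Type*} [Ring A] [Algebra k A]

/-- The matrix through which left multiplication by `t f b` is commuted past the
derivations; the index `none` stands for the identity operator. -/
def crossing (G : Matrix (I × I) (I × I) k) (t : I → I → A) (f b : I) :
    Matrix (Option (I × I)) (Option (I × I)) A :=
  Matrix.of fun x y => match x, y with
    | some x, some y => ∑ d, ∑ j, (G (x.1, d) (f, y.1) * G (x.2, j) (b, y.2)) • t d j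
    | some x, none => algebraMap k A (if x = (f, b) then 1 else 0)
    | none, some _ => 0
    | none, none => t f b

/-- A matrix `G` subject to the properties needed for the quantum Weyl algebra. -/
structure IsHeckeBraiding (μ : k) (G : Matrix (I × I) (I × I) k) : Prop where
  symm : ∀ p c, G p c = G c p
  mul_self : G * G = μ • G + 1
  commute : ∀ e l, Commute G (transfer G e l)

theorem IsHeckeBraiding.commute_transpose {μ : k} {G : Matrix (I × I) (I × I) k}
    (hG : IsHeckeBraiding μ G) (e l : I) : Commute G (transfer G e l).transpose := by
  have hT : G.transpose = G := by
    ext p c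
    exact hG.symm c p
  have h := congrArg Matrix.transpose (hG.commute e l).eq
  rw [Matrix.transpose_mul, Matrix.transpose_mul, hT] at h
  exact h.symm

omit [DecidableEq I] in
theorem sum_six_comm {M : Type*} [AddCommMonoid M] (F : I → I → I → I → I → I → M) :
    ∑ u, ∑ v, ∑ d, ∑ j, ∑ d', ∑ j', F u v d j d' j' =
      ∑ d, ∑ d', ∑ j, ∑ j', ∑ u, ∑ v, F u v d j d' j' := by
  simp only [← Fintype.sum_prod_type']
  exact Fintype.sum_equiv
    { toFun := fun ⟨u, v, d, j, d', j'⟩ => ⟨d, d', j, j', u, v⟩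
      invFun := fun ⟨d, d', j, j', u, v⟩ => ⟨u, v, d, j, d', j'⟩
      left_inv := fun _ => rfl
      right_inv := fun _ => rfl } _ _ fun _ => rfl

theorem intertwines_crossing {μ : k} {G : Matrix (I × I) (I × I) k} (hG : IsHeckeBraiding μ G)
    {t : I → I → A} (ht : Intertwines G fun p c : I × I => t p.1 c.1 * t p.2 c.2) :
    Intertwines G fun p c : I × I => crossing G t p.1 c.1 * crossing G t p.2 c.2 := by
  have entry : ∀ x y, Intertwines G fun p c : I × I =>
      (crossing G t p.1 c.1 * crossing G t p.2 c.2) x y := by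
    rintro (_ | ⟨e, a⟩) (_ | ⟨l, m⟩)
    · simpa [Matrix.mul_apply, crossing] using ht
    · convert Intertwines.zero (G := G) (M := A) using 1
      funext p c
      simp [Matrix.mul_apply, crossing]
    · convert Intertwines.of_hecke hG.mul_self
        (fun p c : I × I => if (e, a) = (p.1, c.1) then t p.2 c.2 else 0) using 1
      funext ⟨f, g⟩ ⟨b, c⟩
      simp only [Matrix.mul_apply, crossing, Fintype.sum_option, sandwich, Pi.add_apply,
        Fintype.sum_prod_type, Matrix.of_apply]
      simp [apply_ite (algebraMap k A), ite_and, Finset.sum_ite_eq, hG.symm (f, g), add_comm]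
    · convert ht.conj (hG.commute_transpose e l) (hG.commute a m) using 1
      funext ⟨f, g⟩ ⟨b, c⟩
      simp only [Matrix.mul_apply, crossing, Fintype.sum_option, sandwich,
        Fintype.sum_prod_type, Matrix.of_apply, Matrix.transpose_apply, transfer, Matrix.of_apply]
      simp only [mul_zero, zero_add, Finset.sum_mul]
      simp only [Finset.mul_sum, Finset.sum_smul, smul_mul_smul_comm]
      rw [sum_six_comm]
      simp only [mul_mul_mul_comm]
  funext p c
  ext x y
  have h := congrFun (congrFun (entry x y) p) c
  have hmap := sandwich_map (ι := I × I) (Matrix.entryLinearMap k A x y)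
  simp only [Matrix.entryLinearMap_apply] at hmap
  rwa [hmap, hmap] at h

end Crossing

section Representation

open TensorProduct

variable {k : Type*} [CommRing k] {I : Type*} [Fintype I] [DecidableEq I]
  {A B : Type*} [Ring A] [Algebra k A] [Ring B] [Algebra k B]

/-- The operator on `A ⊗ B` attached to an index: `some x` gives the quantum derivation `∂ₓ`,
and `none` the identity. -/
def derivOp (Θ : A →ₐ[k] Matrix (Option (I × I)) (Option (I × I)) A) (d : I × I → B)
    (x : Option (I × I)) : Module.End k (A ⊗[k] B) :=
  ∑ y, TensorProduct.map (Matrix.entryLinearMap k A x y ∘ₗ Θ.toLinearMap)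
    (LinearMap.mulLeft k (y.elim 1 d))

variable (Θ : A →ₐ[k] Matrix (Option (I × I)) (Option (I × I)) A) (d : I × I → B)

theorem derivOp_tmul (x : Option (I × I)) (a : A) (b : B) :
    derivOp Θ d x (a ⊗ₜ b) = ∑ y, Θ a x y ⊗ₜ (y.elim 1 d * b) := by
  simp [derivOp]

theorem derivOp_one_tmul (x : I × I) (b : B) :
    derivOp Θ d (some x) ((1 : A) ⊗ₜ[k] b) = 1 ⊗ₜ (d x * b) := by
  simp [derivOp_tmul, Matrix.one_apply, ite_tmul, Finset.sum_ite_eq]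

theorem derivOp_mul (x : Option (I × I)) (a : A) (w : A ⊗[k] B) :
    derivOp Θ d x ((a ⊗ₜ 1) * w) = ∑ z, (Θ a x z ⊗ₜ 1) * derivOp Θ d z w := by
  induction w with
  | zero => simp
  | add v w hv hw => simp only [mul_add, map_add, hv, hw, Finset.sum_add_distrib]
  | tmul a' b =>
    simp only [Algebra.TensorProduct.tmul_mul_tmul, one_mul, derivOp_tmul, map_mul,
      Matrix.mul_apply, Finset.mul_sum, sum_tmul]
    exact Finset.sum_comm

variable {Θ} {t : I → I → A} {G : Matrix (I × I) (I × I) k}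

theorem apply_none_of_crossing (hA : Algebra.adjoin k (Set.range fun p : I × I => t p.1 p.2) = ⊤)
    (hΘ : ∀ f b, Θ (t f b) = crossing G t f b) (a : A) (y : Option (I × I)) :
    Θ a none y = if y = none then a else 0 := by
  have ha : a ∈ Algebra.adjoin k (Set.range fun p : I × I => t p.1 p.2) := hA ▸ trivial
  induction ha using Algebra.adjoin_induction generalizing y with
  | mem x hx =>
    obtain ⟨p, rfl⟩ := hx
    rw [hΘ]
    cases y <;> simp [crossing]
  | algebraMap r =>
    rw [AlgHomClass.commutes, Matrix.algebraMap_matrix_apply]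
    simp only [eq_comm]
  | add a a' _ _ h h' =>
    rw [map_add, Matrix.add_apply, h, h']
    split_ifs <;> simp
  | mul a a' _ _ h h' =>
    simp only [map_mul, Matrix.mul_apply, h, ite_mul, zero_mul]
    rw [Finset.sum_ite_eq' Finset.univ none, if_pos (Finset.mem_univ _), h', mul_ite, mul_zero]

theorem derivOp_none (hA : Algebra.adjoin k (Set.range fun p : I × I => t p.1 p.2) = ⊤)
    (hΘ : ∀ f b, Θ (t f b) = crossing G t f b) (w : A ⊗[k] B) : derivOp Θ d none w = w := by
  induction w with
  | zero => simp
  | add v w hv hw => rw [map_add, hv, hw]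
  | tmul a b => simp [derivOp_tmul, apply_none_of_crossing hA hΘ, ite_tmul]

omit [DecidableEq I] in
theorem sum_four_comm {M : Type*} [AddCommMonoid M] (F : I → I → I → I → M) :
    ∑ l, ∑ m, ∑ d, ∑ j, F l m d j = ∑ d, ∑ j, ∑ l, ∑ m, F l m d j := by
  simp only [← Fintype.sum_prod_type']
  exact Fintype.sum_equiv
    { toFun := fun ⟨l, m, d, j⟩ => ⟨d, j, l, m⟩
      invFun := fun ⟨d, j, l, m⟩ => ⟨l, m, d, j⟩
      left_inv := fun _ => rfl
      right_inv := fun _ => rfl } _ _ fun _ => rfl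

theorem derivOp_gen_mul (hA : Algebra.adjoin k (Set.range fun p : I × I => t p.1 p.2) = ⊤)
    (hΘ : ∀ f b, Θ (t f b) = crossing G t f b) (e a f b : I) (w : A ⊗[k] B) :
    derivOp Θ d (some (e, a)) ((t f b ⊗ₜ 1) * w) =
      (∑ d', ∑ j, ∑ l, ∑ m, (G (e, d') (f, l) * G (a, j) (b, m)) •
        ((t d' j ⊗ₜ 1) * derivOp Θ d (some (l, m)) w)) +
          (if (e, a) = (f, b) then 1 else 0 : k) • w := by
  rw [derivOp_mul, Fintype.sum_option, hΘ, derivOp_none d hA hΘ, add_comm]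
  congr 1
  · simp only [crossing, Matrix.of_apply, sum_tmul, Finset.sum_mul, Fintype.sum_prod_type,
      ← smul_tmul', smul_mul_assoc]
    exact sum_four_comm _
  · simp only [crossing, Matrix.of_apply, Algebra.algebraMap_eq_smul_one, ← smul_tmul',
      smul_mul_assoc, ← Algebra.TensorProduct.one_def, one_mul]

omit [DecidableEq I] in
theorem sum_eight_comm {M : Type*} [AddCommMonoid M] (F : I → I → I → I → I → I → I → I → M) :
    ∑ d, ∑ j, ∑ l, ∑ m, ∑ d', ∑ j', ∑ l', ∑ m', F d j l m d' j' l' m' =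
      ∑ d', ∑ j', ∑ l, ∑ l', ∑ m, ∑ m', ∑ d, ∑ j, F d j l m d' j' l' m' := by
  simp only [← Fintype.sum_prod_type']
  exact Fintype.sum_equiv
    { toFun := fun ⟨d, j, l, m, d', j', l', m'⟩ => ⟨d', j', l, l', m, m', d, j⟩
      invFun := fun ⟨d', j', l, l', m, m', d, j⟩ => ⟨d, j, l, m, d', j', l', m'⟩
      left_inv := fun _ => rfl
      right_inv := fun _ => rfl } _ _ fun _ => rfl

/-- The quadratic relations between operators `D` propagate along operators `T` satisfying the
cross relations of the quantum Weyl algebra. -/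
theorem intertwines_of_cross {M : Type*} [AddCommGroup M] [Module k M] {μ : k}
    (hG : IsHeckeBraiding μ G) (T : I → I → Module.End k M) (D : I × I → Module.End k M)
    (cross : ∀ e a f b w, D (e, a) (T f b w) =
      (∑ d', ∑ j, ∑ l, ∑ m, (G (f, l) (e, d') * G (b, m) (a, j)) • T d' j (D (l, m) w)) +
        (if (e, a) = (f, b) then 1 else 0 : k) • w)
    (f b : I) (w : M)
    (hw : Intertwines G fun p c : I × I => D (p.2, c.2) (D (p.1, c.1) w)) :
    Intertwines G fun p c : I × I => D (p.2, c.2) (D (p.1, c.1) (T f b w)) := by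
  have hquad : Intertwines G (∑ d', ∑ j, fun p c => T d' j
      (sandwich (transfer G f d').transpose (fun p c : I × I => D (p.2, c.2) (D (p.1, c.1) w))
        (transfer G b j) p c)) :=
    Intertwines.sum fun d' _ => Intertwines.sum fun j _ =>
      (hw.conj (hG.commute_transpose f d') (hG.commute b j)).map (T d' j)
  have hlin := Intertwines.of_hecke hG.mul_self fun p c : I × I =>
    if (p.1, c.1) = (f, b) then D (p.2, c.2) w else 0
  convert hquad.add hlin using 1
  funext ⟨e', e⟩ ⟨a', a⟩
  simp only [cross, map_add, map_sum, map_smul, Pi.add_apply, Finset.sum_apply, smul_add,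
    Finset.sum_add_distrib, add_assoc]
  congr 1
  · simp only [sandwich, transfer, Matrix.transpose_apply, Matrix.of_apply,
      Fintype.sum_prod_type, map_sum, map_smul, Finset.smul_sum, smul_smul, Finset.sum_mul]
    simp only [Finset.mul_sum, Finset.sum_smul]
    rw [sum_eight_comm]
    simp only [mul_mul_mul_comm]
  congr 1
  · simp [sandwich, Fintype.sum_prod_type, ite_and, hG.symm (f, _)]
  · simp

theorem intertwines_derivOp {μ : k} (hG : IsHeckeBraiding μ G)
    (hA : Algebra.adjoin k (Set.range fun p : I × I => t p.1 p.2) = ⊤)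
    (hΘ : ∀ f b, Θ (t f b) = crossing G t f b)
    (hd : Intertwines G fun p c : I × I => d (p.2, c.2) * d (p.1, c.1)) :
    Intertwines G fun p c : I × I =>
      derivOp Θ d (some (p.2, c.2)) * derivOp Θ d (some (p.1, c.1)) := by
  let Z : A ⊗[k] B → I × I → I × I → A ⊗[k] B := fun w p c =>
    derivOp Θ d (some (p.2, c.2)) (derivOp Θ d (some (p.1, c.1)) w)
  have hadd : ∀ v w, Z (v + w) = Z v + Z w := by
    intro v w
    funext p c
    simp [Z]
  have hgen : ∀ f b w, Intertwines G (Z w) → Intertwines G (Z ((t f b ⊗ₜ 1) * w)) := by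
    refine intertwines_of_cross hG (fun f b => LinearMap.mulLeft k (t f b ⊗ₜ[k] (1 : B)))
      (fun x => derivOp Θ d (some x)) fun e a f b w => ?_
    simp only [LinearMap.mulLeft_apply, derivOp_gen_mul d hA hΘ, hG.symm (f, _), hG.symm (b, _)]
  have hmul : ∀ a w, Intertwines G (Z w) → Intertwines G (Z ((a ⊗ₜ 1) * w)) := by
    intro a
    have ha : a ∈ Algebra.adjoin k (Set.range fun p : I × I => t p.1 p.2) := hA ▸ trivial
    induction ha using Algebra.adjoin_induction with
    | mem x hx =>
      obtain ⟨p, rfl⟩ := hx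
      exact hgen p.1 p.2
    | algebraMap r =>
      intro w hw
      convert hw.map (r • (LinearMap.id : (A ⊗[k] B) →ₗ[k] (A ⊗[k] B))) using 1
      funext p c
      simp [Z, Algebra.algebraMap_eq_smul_one, ← smul_tmul', ← Algebra.TensorProduct.one_def]
    | add a a' _ _ h h' =>
      intro w hw
      rw [add_tmul, add_mul, hadd]
      exact (h w hw).add (h' w hw)
    | mul a a' _ _ h h' =>
      intro w hw
      have := h _ (h' w hw)
      rwa [← mul_assoc, Algebra.TensorProduct.tmul_mul_tmul, one_mul] at this
  have hZ : ∀ w, Intertwines G (Z w) := by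
    intro w
    induction w with
    | zero =>
      convert Intertwines.zero (G := G) (M := A ⊗[k] B) using 1
      funext p c
      simp [Z]
    | add v w hv hw =>
      rw [hadd]
      exact hv.add hw
    | tmul a b =>
      have h1 : Intertwines G (Z (1 ⊗ₜ b)) := by
        convert hd.map (TensorProduct.mk k A B 1 ∘ₗ LinearMap.mulRight k b) using 1
        funext p c
        simp [Z, derivOp_one_tmul, mul_assoc]
      simpa using hmul a _ h1
  funext p c
  refine LinearMap.ext fun w => ?_
  have h := congrFun (congrFun (hZ w) p) c
  have hmap := sandwich_map (ι := I × I) (LinearMap.applyₗ (R := k) (M₂ := A ⊗[k] B) w)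
  simp only [LinearMap.applyₗ_apply_apply] at hmap
  have h1 := hmap G 1 fun p c => derivOp Θ d (some (p.2, c.2)) * derivOp Θ d (some (p.1, c.1))
  have h2 := hmap 1 G fun p c => derivOp Θ d (some (p.2, c.2)) * derivOp Θ d (some (p.1, c.1))
  exact (congrFun (congrFun h1 p) c).symm.trans (h.trans (congrFun (congrFun h2 p) c))

end Representation

section WeylAlgebra

open TensorProduct

variable {N : ℕ}

theorem q_ne_zero : q ≠ 0 := RatFunc.X_ne_zero

theorem q_mul_inv : q * q⁻¹ = 1 := mul_inv_cancel₀ q_ne_zero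

theorem isHeckeBraiding_hecke {k I : Type*} [CommRing k] [Fintype I] [DecidableEq I] {a b : k}
    (hab : a * b = 1) (r : I → I → Prop) [DecidableRel r] [IsStrictTotalOrder I r] :
    IsHeckeBraiding (a - b) (hecke a b r) where
  symm := hecke_symm a b r
  mul_self := hecke_mul_self a b r hab
  commute := commute_transfer (hecke_braid a b r hab)

/-- The braiding `P R_υ`, up to the flip of its rows. -/
def braiding (N : ℕ) (υ : Fin 2) : Matrix (Fin N × Fin N) (Fin N × Fin N) K :=
  if υ = 0 then hecke q q⁻¹ (· < ·) else hecke q⁻¹ q (· > ·)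

theorem isHeckeBraiding_braiding (N : ℕ) (υ : Fin 2) :
    ∃ μ : K, IsHeckeBraiding μ (braiding N υ) := by
  unfold braiding
  split_ifs
  · exact ⟨_, isHeckeBraiding_hecke q_mul_inv _⟩
  · exact ⟨_, isHeckeBraiding_hecke (mul_comm q q⁻¹ ▸ q_mul_inv) _⟩

theorem hecke_inv_add (N : ℕ) :
    hecke q⁻¹ q (· > · : Fin N → Fin N → Prop) + (q - q⁻¹) • 1 = hecke q q⁻¹ (· < ·) := by
  ext ⟨i, j⟩ c
  simp only [hecke, Matrix.of_apply, Matrix.add_apply, Matrix.smul_apply, Matrix.one_apply,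
    smul_eq_mul, eq_comm (a := (i, j)) (b := c), Prod.swap, gt_iff_lt]
  rcases lt_trichotomy i j with h | rfl | h
  · simp only [h, h.not_gt, h.ne, if_true, if_false]
    split_ifs <;> ring
  · simp only [lt_irrefl, if_true, if_false]
    split_ifs <;> ring
  · simp only [h, h.not_gt, h.ne', if_true, if_false]
    split_ifs <;> ring

theorem intertwines_braiding_iff {M : Type*} [AddCommGroup M] [Module K M] (υ : Fin 2)
    (Z : Fin N × Fin N → Fin N × Fin N → M) :
    Intertwines (braiding N υ) Z ↔ Intertwines (hecke q q⁻¹ (· < ·)) Z := by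
  unfold braiding
  split_ifs
  · rfl
  · rw [← hecke_inv_add, Intertwines.sub_smul_one_iff]

theorem Rmat_apply (i j : Fin N) (c : Fin N × Fin N) :
    Rmat N (j, i) c = hecke q q⁻¹ (· < ·) (i, j) c := by
  obtain ⟨m, l⟩ := c
  simp only [Rmat, hecke, Matrix.of_apply, Prod.swap, Prod.mk.injEq]
  grind

theorem Rv_apply (υ : Fin 2) (i j : Fin N) (c : Fin N × Fin N) :
    Rv N υ (j, i) c = braiding N υ (i, j) c := by
  unfold Rv braiding
  split_ifs
  · exact Rmat_apply i j c
  · have h : flip21 (Rmat N) *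
        Matrix.of (fun p c => hecke q⁻¹ q (· > ·) (Prod.swap p) c) = 1 := by
      have h1 : hecke q q⁻¹ (· < ·) * hecke q⁻¹ q (· > · : Fin N → Fin N → Prop) = 1 := by
        have h2 := hecke_mul_self q q⁻¹ (· < · : Fin N → Fin N → Prop) q_mul_inv
        rw [← sub_eq_iff_eq_add'] at h2
        rw [← h2, eq_sub_of_add_eq (hecke_inv_add N), mul_sub, mul_smul_comm, mul_one]
      ext ⟨i, j⟩ c
      rw [← h1, Matrix.mul_apply, Matrix.mul_apply]
      refine Fintype.sum_equiv (Equiv.prodComm _ _) _ _ fun x => ?_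
      simp [flip21, Rmat_apply, Prod.swap]
    rw [Matrix.inv_eq_right_inv h]
    rfl

theorem isQuantumMatrix_tGen : IsQuantumMatrix q q⁻¹ (tGen (n := N)) where
  row l i j h := by simpa [tGen] using RingQuot.mkAlgHom_rel K (matRel.rowq l i j h)
  col l i j h := by simpa [tGen] using RingQuot.mkAlgHom_rel K (matRel.colq l i j h)
  anti i k j l h1 h2 := by simpa [tGen] using RingQuot.mkAlgHom_rel K (matRel.anti i k j l h1 h2)
  main i k j l h1 h2 := by simpa [tGen] using RingQuot.mkAlgHom_rel K (matRel.main i k j l h1 h2)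

theorem isQuantumMatrix_pGen :
    IsQuantumMatrix q q⁻¹ (fun i j => MulOpposite.op (pGen (n := N) i j)) where
  row l i j h := by
    simpa [pGen, ← MulOpposite.op_mul, ← MulOpposite.op_smul] using
      RingQuot.mkAlgHom_rel K (matRelOp.rowq l i j h)
  col l i j h := by
    simpa [pGen, ← MulOpposite.op_mul, ← MulOpposite.op_smul] using
      RingQuot.mkAlgHom_rel K (matRelOp.colq l i j h)
  anti i k j l h1 h2 := by
    simpa [pGen, ← MulOpposite.op_mul] using
      RingQuot.mkAlgHom_rel K (matRelOp.anti i k j l h1 h2)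
  main i k j l h1 h2 := by
    simpa [pGen, ← MulOpposite.op_mul, ← MulOpposite.op_smul, ← MulOpposite.op_add] using
      RingQuot.mkAlgHom_rel K (matRelOp.main i k j l h1 h2)

theorem isQuantumMatrix_tWtt (υ : Fin 2) : IsQuantumMatrix q q⁻¹ (tWtt N υ) where
  row l i j h := by simpa [tWtt] using RingQuot.mkAlgHom_rel K (wRel.trowq (υ := υ) l i j h)
  col l i j h := by simpa [tWtt] using RingQuot.mkAlgHom_rel K (wRel.tcolq (υ := υ) l i j h)
  anti i k j l h1 h2 := by
    simpa [tWtt] using RingQuot.mkAlgHom_rel K (wRel.tanti (υ := υ) i k j l h1 h2)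
  main i k j l h1 h2 := by
    simpa [tWtt] using RingQuot.mkAlgHom_rel K (wRel.tmain (υ := υ) i k j l h1 h2)

theorem isQuantumMatrix_dWtt (υ : Fin 2) :
    IsQuantumMatrix q q⁻¹ (fun i j => MulOpposite.op (dWtt N υ i j)) where
  row l i j h := by
    simpa [dWtt, ← MulOpposite.op_mul, ← MulOpposite.op_smul] using
      RingQuot.mkAlgHom_rel K (wRel.drowq (υ := υ) l i j h)
  col l i j h := by
    simpa [dWtt, ← MulOpposite.op_mul, ← MulOpposite.op_smul] using
      RingQuot.mkAlgHom_rel K (wRel.dcolq (υ := υ) l i j h)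
  anti i k j l h1 h2 := by
    simpa [dWtt, ← MulOpposite.op_mul] using
      RingQuot.mkAlgHom_rel K (wRel.danti (υ := υ) i k j l h1 h2)
  main i k j l h1 h2 := by
    simpa [dWtt, ← MulOpposite.op_mul, ← MulOpposite.op_smul, ← MulOpposite.op_add] using
      RingQuot.mkAlgHom_rel K (wRel.dmain (υ := υ) i k j l h1 h2)

theorem cross_coeff (υ : Fin 2) (e a f b d l j m : Fin N) :
    pt2 (Rv N υ) (d, l) (f, e) * pt2 (Rv N υ) (j, m) (b, a) =
      braiding N υ (e, d) (f, l) * braiding N υ (a, j) (b, m) := by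
  simp [pt2, Rv_apply]

theorem dWtt_mul_tWtt (υ : Fin 2) (e a f b : Fin N) :
    dWtt N υ e a * tWtt N υ f b =
      (∑ d, ∑ l, ∑ j, ∑ m, (braiding N υ (e, d) (f, l) * braiding N υ (a, j) (b, m)) •
        (tWtt N υ d j * dWtt N υ l m)) +
        algebraMap K _ ((if e = f then (1 : K) else 0) * (if a = b then (1 : K) else 0)) := by
  have h := RingQuot.mkAlgHom_rel K (wRel.cross (υ := υ) e a f b)
  simp only [cross_coeff, map_add, map_sum, map_smul, map_mul, AlgHom.commutes] at h
  simpa only [tWtt, dWtt, map_mul] using h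

/-- The homomorphism out of the quantized function algebra given by a quantum matrix. -/
theorem exists_lift_tGen {C : Type*} [Ring C] [Algebra K C] {t : Fin N → Fin N → C}
    (ht : IsQuantumMatrix q q⁻¹ t) : ∃ φ : OqMat N →ₐ[K] C, ∀ i j, φ (tGen i j) = t i j := by
  refine ⟨RingQuot.liftAlgHom K ⟨FreeAlgebra.lift K fun p => t p.1 p.2, ?_⟩, ?_⟩
  · intro x y h
    cases h with
    | rowq l i j h => simpa [Tg] using ht.row l i j h
    | colq l i j h => simpa [Tg] using ht.col l i j h
    | anti i k j l h1 h2 => simpa [Tg] using ht.anti i k j l h1 h2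
    | main i k j l h1 h2 => simpa [Tg] using ht.main i k j l h1 h2
  · intro i j
    simp [tGen, Tg]

theorem exists_lift_pGen {C : Type*} [Ring C] [Algebra K C] {d : Fin N → Fin N → C}
    (hd : IsQuantumMatrix q q⁻¹ fun i j => MulOpposite.op (d i j)) :
    ∃ φ : OqMatOp N →ₐ[K] C, ∀ i j, φ (pGen i j) = d i j := by
  refine ⟨RingQuot.liftAlgHom K ⟨FreeAlgebra.lift K fun p => d p.1 p.2, ?_⟩, ?_⟩
  · intro x y h
    cases h with
    | rowq l i j h => simpa [Tg] using congrArg MulOpposite.unop (hd.row l i j h)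
    | colq l i j h => simpa [Tg] using congrArg MulOpposite.unop (hd.col l i j h)
    | anti i k j l h1 h2 => simpa [Tg] using congrArg MulOpposite.unop (hd.anti i k j l h1 h2)
    | main i k j l h1 h2 => simpa [Tg] using congrArg MulOpposite.unop (hd.main i k j l h1 h2)
  · intro i j
    simp [pGen, Tg]

theorem exists_lift_Wtt {C : Type*} [Ring C] [Algebra K C] {υ : Fin 2} {t d : Fin N → Fin N → C}
    (ht : IsQuantumMatrix q q⁻¹ t) (hd : IsQuantumMatrix q q⁻¹ fun i j => MulOpposite.op (d i j))
    (cross : ∀ e a f b, d e a * t f b =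
      (∑ d', ∑ j, ∑ l, ∑ m, (braiding N υ (e, d') (f, l) * braiding N υ (a, j) (b, m)) •
        (t d' j * d l m)) + (if (e, a) = (f, b) then 1 else 0 : K) • 1) :
    ∃ ρ : Wtt N υ →ₐ[K] C, (∀ i j, ρ (tWtt N υ i j) = t i j) ∧
      ∀ i j, ρ (dWtt N υ i j) = d i j := by
  refine ⟨RingQuot.liftAlgHom K ⟨FreeAlgebra.lift K
    (Sum.elim (fun p => t p.1 p.2) fun p => d p.1 p.2), ?_⟩, ?_, ?_⟩
  · intro x y h
    cases h with
    | trowq l i j h => simpa [tF] using ht.row l i j h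
    | tcolq l i j h => simpa [tF] using ht.col l i j h
    | tanti i k j l h1 h2 => simpa [tF] using ht.anti i k j l h1 h2
    | tmain i k j l h1 h2 => simpa [tF] using ht.main i k j l h1 h2
    | drowq l i j h => simpa [dF] using congrArg MulOpposite.unop (hd.row l i j h)
    | dcolq l i j h => simpa [dF] using congrArg MulOpposite.unop (hd.col l i j h)
    | danti i k j l h1 h2 => simpa [dF] using congrArg MulOpposite.unop (hd.anti i k j l h1 h2)
    | dmain i k j l h1 h2 => simpa [dF] using congrArg MulOpposite.unop (hd.main i k j l h1 h2)
    | cross e a f b =>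
      simp only [cross_coeff, map_add, map_sum, map_smul, map_mul, AlgHom.commutes, tF, dF,
        FreeAlgebra.lift_ι_apply, Sum.elim_inl, Sum.elim_inr, cross]
      congr 1
      · exact Finset.sum_congr rfl fun _ _ => Finset.sum_comm
      · by_cases h1 : e = f <;> by_cases h2 : a = b <;> simp [h1, h2]
  · intro i j
    simp [tWtt, tF]
  · intro i j
    simp [dWtt, dF]

theorem adjoin_mkAlgHom_ι {X : Type*} (r : FreeAlgebra K X → FreeAlgebra K X → Prop) :
    Algebra.adjoin K (Set.range fun x => RingQuot.mkAlgHom K r (FreeAlgebra.ι K x)) = ⊤ := by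
  rw [Set.range_comp' (RingQuot.mkAlgHom K r), ← AlgHom.map_adjoin, FreeAlgebra.adjoin_range_ι,
    Algebra.map_top, AlgHom.range_eq_top]
  exact RingQuot.mkAlgHom_surjective K r

theorem adjoin_tGen : Algebra.adjoin K (Set.range fun p : Fin N × Fin N => tGen p.1 p.2) = ⊤ :=
  adjoin_mkAlgHom_ι _

theorem adjoin_pGen : Algebra.adjoin K (Set.range fun p : Fin N × Fin N => pGen p.1 p.2) = ⊤ :=
  adjoin_mkAlgHom_ι _

/-- The quantum Weyl algebra acts on `A ⊗ B` whenever `A` is generated by a quantum matrix `t`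
past which the derivations can be commuted, and `B` contains an opposite quantum matrix `p`. -/
theorem exists_action {A B : Type*} [Ring A] [Algebra K A] [Ring B] [Algebra K B] {υ : Fin 2}
    {t : Fin N → Fin N → A} {p : Fin N → Fin N → B} (ht : IsQuantumMatrix q q⁻¹ t)
    (hp : IsQuantumMatrix q q⁻¹ fun i j => MulOpposite.op (p i j))
    (hA : Algebra.adjoin K (Set.range fun x : Fin N × Fin N => t x.1 x.2) = ⊤)
    {Θ : A →ₐ[K] Matrix (Option (Fin N × Fin N)) (Option (Fin N × Fin N)) A}
    (hΘ : ∀ f b, Θ (t f b) = crossing (braiding N υ) t f b) :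
    ∃ ρ : Wtt N υ →ₐ[K] Module.End K (A ⊗[K] B),
      (∀ i j w, ρ (tWtt N υ i j) w = (t i j ⊗ₜ 1) * w) ∧
      ∀ i j b, ρ (dWtt N υ i j) (1 ⊗ₜ b) = 1 ⊗ₜ (p i j * b) := by
  obtain ⟨μ, hG⟩ := isHeckeBraiding_braiding N υ
  have hd := (intertwines_braiding_iff υ _).2 ((isQuantumMatrix_op_iff q_mul_inv _).1 hp)
  let d : Fin N × Fin N → B := fun x => p x.1 x.2
  have hD := intertwines_derivOp d hG hA hΘ hd
  rw [intertwines_braiding_iff,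
    ← isQuantumMatrix_op_iff q_mul_inv fun i j => derivOp Θ d (some (i, j))] at hD
  have hT := ht.map ((Algebra.lmul K (A ⊗[K] B)).comp Algebra.TensorProduct.includeLeft)
  obtain ⟨ρ, h1, h2⟩ := exists_lift_Wtt (υ := υ) hT hD (by
    intro e a f b
    refine LinearMap.ext fun w => ?_
    have h := derivOp_gen_mul d hA hΘ e a f b w
    by_cases hef : e = f ∧ a = b <;> simpa [hef, LinearMap.sum_apply] using h)
  refine ⟨ρ, fun i j w => ?_, fun i j b => ?_⟩
  · rw [h1]
    rfl
  · rw [h2, derivOp_one_tmul]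

theorem exists_representation (N : ℕ) (υ : Fin 2) :
    ∃ ρ : Wtt N υ →ₐ[K] Module.End K (OqMat N ⊗[K] OqMatOp N),
      (∀ i j w, ρ (tWtt N υ i j) w = (tGen i j ⊗ₜ 1) * w) ∧
      ∀ i j b, ρ (dWtt N υ i j) (1 ⊗ₜ b) = 1 ⊗ₜ (pGen i j * b) := by
  obtain ⟨μ, hG⟩ := isHeckeBraiding_braiding N υ
  have hΘ := intertwines_crossing hG ((intertwines_braiding_iff υ _).2
    ((isQuantumMatrix_iff q_mul_inv _).1 (isQuantumMatrix_tGen (N := N))))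
  rw [intertwines_braiding_iff, ← isQuantumMatrix_iff q_mul_inv] at hΘ
  obtain ⟨Θ, hΘ⟩ := exists_lift_tGen hΘ
  exact exists_action isQuantumMatrix_tGen isQuantumMatrix_pGen adjoin_tGen hΘ

variable {υ : Fin 2} {φT : OqMat N →ₐ[K] Wtt N υ} {φD : OqMatOp N →ₐ[K] Wtt N υ}

theorem injective_mul_map (hT : ∀ i j, φT (tGen i j) = tWtt N υ i j)
    (hD : ∀ i j, φD (pGen i j) = dWtt N υ i j) :
    Function.Injective (LinearMap.mul' K (Wtt N υ) ∘ₗ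
      TensorProduct.map φT.toLinearMap φD.toLinearMap) := by
  obtain ⟨ρ, h1, h2⟩ := exists_representation N υ
  have hρT : ∀ a w, ρ (φT a) w = (a ⊗ₜ 1) * w := by
    intro a
    have ha : a ∈ Algebra.adjoin K (Set.range fun p : Fin N × Fin N => tGen p.1 p.2) :=
      adjoin_tGen ▸ trivial
    induction ha using Algebra.adjoin_induction with
    | mem x hx =>
      obtain ⟨p, rfl⟩ := hx
      intro w
      rw [hT, h1]
    | algebraMap r =>
      intro w
      simp [Algebra.algebraMap_eq_smul_one, ← smul_tmul', ← Algebra.TensorProduct.one_def]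
    | add a a' _ _ h h' =>
      intro w
      rw [map_add, map_add, LinearMap.add_apply, h, h', add_tmul, add_mul]
    | mul a a' _ _ h h' =>
      intro w
      rw [map_mul, map_mul, Module.End.mul_apply, h, h', ← mul_assoc,
        Algebra.TensorProduct.tmul_mul_tmul, one_mul]
  have hρD : ∀ b b', ρ (φD b) (1 ⊗ₜ b') = 1 ⊗ₜ (b * b') := by
    intro b
    have hb : b ∈ Algebra.adjoin K (Set.range fun p : Fin N × Fin N => pGen p.1 p.2) :=
      adjoin_pGen ▸ trivial
    induction hb using Algebra.adjoin_induction with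
    | mem x hx =>
      obtain ⟨p, rfl⟩ := hx
      intro w
      rw [hD, h2]
    | algebraMap r =>
      intro w
      simp [Algebra.algebraMap_eq_smul_one]
    | add a a' _ _ h h' =>
      intro w
      rw [map_add, map_add, LinearMap.add_apply, h, h', ← tmul_add, add_mul]
    | mul a a' _ _ h h' =>
      intro w
      rw [map_mul, map_mul, Module.End.mul_apply, h', h, mul_assoc]
  have hinv : (LinearMap.applyₗ (R := K) (M₂ := OqMat N ⊗[K] OqMatOp N)
      ((1 : OqMat N) ⊗ₜ[K] (1 : OqMatOp N)) ∘ₗ ρ.toLinearMap) ∘ₗ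
      (LinearMap.mul' K (Wtt N υ) ∘ₗ TensorProduct.map φT.toLinearMap φD.toLinearMap) =
        LinearMap.id := by
    refine TensorProduct.ext' fun a b => ?_
    simp [hρT, hρD]
  exact LinearMap.injective_of_comp_eq_id _ _ hinv

theorem surjective_mul_map (hT : ∀ i j, φT (tGen i j) = tWtt N υ i j)
    (hD : ∀ i j, φD (pGen i j) = dWtt N υ i j) :
    Function.Surjective (LinearMap.mul' K (Wtt N υ) ∘ₗ
      TensorProduct.map φT.toLinearMap φD.toLinearMap) := by
  set F := LinearMap.mul' K (Wtt N υ) ∘ₗ TensorProduct.map φT.toLinearMap φD.toLinearMap with hF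
  have hFt : ∀ a b, F (a ⊗ₜ b) = φT a * φD b := fun a b => by simp [hF]
  have hleft : ∀ a, ∀ x ∈ LinearMap.range F, φT a * x ∈ LinearMap.range F := by
    rintro a _ ⟨w, rfl⟩
    refine ⟨(a ⊗ₜ 1) * w, ?_⟩
    induction w with
    | zero => simp
    | add v w hv hw => rw [mul_add, map_add, hv, hw, map_add, mul_add]
    | tmul a' b => simp only [Algebra.TensorProduct.tmul_mul_tmul, one_mul, hFt, map_mul, mul_assoc]
  have hstep : ∀ a, ∀ x ∈ LinearMap.range F,
      (∀ i j, dWtt N υ i j * x ∈ LinearMap.range F) →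
        ∀ i j, dWtt N υ i j * (φT a * x) ∈ LinearMap.range F := by
    intro a
    have ha : a ∈ Algebra.adjoin K (Set.range fun p : Fin N × Fin N => tGen p.1 p.2) :=
      adjoin_tGen ▸ trivial
    induction ha using Algebra.adjoin_induction with
    | mem y hy =>
      obtain ⟨⟨f, b⟩, rfl⟩ := hy
      intro x hx hdx e a
      rw [hT, ← mul_assoc, dWtt_mul_tWtt, add_mul, Algebra.algebraMap_eq_smul_one, smul_mul_assoc,
        one_mul]
      refine Submodule.add_mem _ ?_ (Submodule.smul_mem _ _ hx)
      simp only [Finset.sum_mul, smul_mul_assoc, mul_assoc]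
      refine Submodule.sum_mem _ fun d _ => Submodule.sum_mem _ fun l _ =>
        Submodule.sum_mem _ fun j _ => Submodule.sum_mem _ fun m _ => Submodule.smul_mem _ _ ?_
      rw [← hT]
      exact hleft _ _ (hdx l m)
    | algebraMap r =>
      intro x hx hdx i j
      rw [AlgHom.commutes, Algebra.algebraMap_eq_smul_one, smul_mul_assoc, one_mul, mul_smul_comm]
      exact Submodule.smul_mem _ _ (hdx i j)
    | add a a' _ _ h h' =>
      intro x hx hdx i j
      rw [map_add, add_mul, mul_add]
      exact Submodule.add_mem _ (h x hx hdx i j) (h' x hx hdx i j)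
    | mul a a' _ _ h h' =>
      intro x hx hdx
      rw [map_mul, mul_assoc]
      exact h _ (hleft a' x hx) (h' x hx hdx)
  have hderiv : ∀ i j, ∀ x ∈ LinearMap.range F, dWtt N υ i j * x ∈ LinearMap.range F := by
    rintro i j _ ⟨w, rfl⟩
    induction w with
    | zero => simp
    | add v w hv hw =>
      rw [map_add, mul_add]
      exact Submodule.add_mem _ hv hw
    | tmul a b =>
      rw [hFt]
      refine hstep a _ ⟨1 ⊗ₜ b, by rw [hFt, map_one, one_mul]⟩ (fun i j => ?_) i j
      exact ⟨1 ⊗ₜ (pGen i j * b), by rw [hFt, map_one, one_mul, map_mul, hD]⟩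
  have hall : ∀ w, ∀ x ∈ LinearMap.range F, w * x ∈ LinearMap.range F := by
    intro w
    have hw : w ∈ Algebra.adjoin K (Set.range fun x =>
        RingQuot.mkAlgHom K (wRel N υ) (FreeAlgebra.ι K x)) := adjoin_mkAlgHom_ι _ ▸ trivial
    induction hw using Algebra.adjoin_induction with
    | mem y hy =>
      obtain ⟨⟨i, j⟩ | ⟨i, j⟩, rfl⟩ := hy
      · have := hleft (tGen i j)
        rwa [hT] at this
      · exact hderiv i j
    | algebraMap r =>
      intro x hx
      rw [Algebra.algebraMap_eq_smul_one, smul_mul_assoc, one_mul]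
      exact Submodule.smul_mem _ _ hx
    | add a a' _ _ h h' =>
      intro x hx
      rw [add_mul]
      exact Submodule.add_mem _ (h x hx) (h' x hx)
    | mul a a' _ _ h h' =>
      intro x hx
      rw [mul_assoc]
      exact h _ (h' x hx)
  intro w
  have h1 : (1 : Wtt N υ) ∈ LinearMap.range F := ⟨1 ⊗ₜ 1, by rw [hFt, map_one, map_one, one_mul]⟩
  simpa using hall w 1 h1

end WeylAlgebra

theorem stmt17 (N : ℕ) (hN : 1 ≤ N) (υ : Fin 2) :
    ∃ (φT : OqMat N →ₐ[K] Wtt N υ) (φD : OqMatOp N →ₐ[K] Wtt N υ),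
      (∀ i j : Fin N, φT (tGen i j) = tWtt N υ i j) ∧
      (∀ i j : Fin N, φD (pGen i j) = dWtt N υ i j) ∧
      Function.Bijective
        (LinearMap.mul' K (Wtt N υ) ∘ₗ
          TensorProduct.map φT.toLinearMap φD.toLinearMap) := by
  obtain ⟨φT, hT⟩ := exists_lift_tGen (isQuantumMatrix_tWtt (N := N) υ)
  obtain ⟨φD, hD⟩ := exists_lift_pGen (isQuantumMatrix_dWtt (N := N) υ)
  exact ⟨φT, φD, hT, hD, injective_mul_map hT hD, surjective_mul_map hT hD⟩
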